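/- Let u be a power of two, let 1 < r ≤ u/2 (r not necessarily a power of two), and let p = 2^b − 1 > u be a (Mersenne) prime. Let h : [u] → [p] be a 4-universal random hash function and define for each key x: h_x = h(x) + 1, j_x = h_x mod 2^{b−1}, i(x) = ⌊r · j_x / 2^{b−1}⌋, a_x = ⌊h_x / 2^{b−1}⌋, and s(x) = 2·a_x − 1 ∈ {−1,1}. For any values f : [u] → ℤ with n = |{x : f(x) ≠ 0}| ≥ 1, the Count Sketch estimator X = Σ_{j∈[r]} ( Σ_{x∈[u]} s(x)·f(x)·[i(x)=j] )² satisfies: (1) E[X] = F₂ + (F₁² − F₂)/p², (2) |E[X] − F₂| ≤ F₂·(n−1)/p², and (3) Var[X] < 2·(1 + (r/2^b)²)·F₂²/r, where F₁ = Σ_x f(x) and F₂ = Σ_x f(x)². -/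

import Mathlib

open MeasureTheory ProbabilityTheory

theorem card_filter_mul_div_eq {M r k : ℕ} (hM : 0 < M) (hr : 0 < r) (hk : k < r) :
    ((Finset.range M).filter fun j => r * j / M = k).card
      = ((k + 1) * M + r - 1) / r - (k * M + r - 1) / r := by
  rw [← Nat.card_Ico]
  congr 1
  ext j
  have hle : (k + 1) * M ≤ r * M := Nat.mul_le_mul_right _ hk
  simp only [Finset.mem_filter, Finset.mem_range, Finset.mem_Ico, Nat.div_eq_iff hM]
  have hlt : j < ((k + 1) * M + r - 1) / r ↔ (j + 1) * r ≤ (k + 1) * M + r - 1 :=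
    Nat.le_div_iff_mul_le hr
  rw [hlt, ← Nat.lt_add_one_iff (m := (k * M + r - 1) / r), Nat.div_lt_iff_lt_mul hr]
  rw [add_one_mul] at hle
  rw [add_one_mul k, add_one_mul j, mul_comm r j]
  constructor
  · rintro ⟨h1, h2⟩
    constructor <;> lia
  · rintro ⟨h1, h2⟩
    refine ⟨?_, by lia⟩
    have : j * r < M * r := by lia
    exact Nat.lt_of_mul_lt_mul_right this

theorem card_filter_mul_div_eq_or {M r k : ℕ} (hM : 0 < M) (hr : 0 < r) (hk : k < r) :
    ((Finset.range M).filter fun j => r * j / M = k).card = (M + r - 1) / r ∨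
      ((Finset.range M).filter fun j => r * j / M = k).card + 1 = (M + r - 1) / r := by
  rw [card_filter_mul_div_eq hM hr hk, add_one_mul]
  have hA := Nat.div_add_mod (k * M + r - 1) r
  have hB := Nat.div_add_mod (k * M + M + r - 1) r
  have hC := Nat.div_add_mod (M + r - 1) r
  have hA' := Nat.mod_lt (k * M + r - 1) hr
  have hB' := Nat.mod_lt (k * M + M + r - 1) hr
  have hC' := Nat.mod_lt (M + r - 1) hr
  have hC0 : 1 ≤ (M + r - 1) / r := (Nat.le_div_iff_mul_le hr).2 (by lia)
  generalize (k * M + r - 1) / r = A at *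
  generalize (k * M + M + r - 1) / r = B at *
  generalize (M + r - 1) / r = C at *
  have h1 : B < A + C + 1 := by
    refine Nat.lt_of_mul_lt_mul_left (a := r) ?_
    rw [mul_add, mul_add]
    lia
  have h2 : A + C < B + 2 := by
    refine Nat.lt_of_mul_lt_mul_left (a := r) ?_
    rw [mul_add, mul_add]
    lia
  lia

theorem sum_fin_succ_eq {M : ℕ} (hM : 0 < M) (F : ℕ → ℝ) :
    ∑ c : Fin (2 * M - 1), F ((c : ℕ) + 1)
      = ∑ j ∈ Finset.range M, (F j + F (M + j)) - F 0 := by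
  rw [Fin.sum_univ_eq_sum_range (fun c => F (c + 1)), Finset.sum_add_distrib,
    ← Finset.sum_range_add, ← two_mul]
  obtain ⟨N, hN⟩ : ∃ N, 2 * M = N + 1 := ⟨2 * M - 1, by lia⟩
  rw [hN, Finset.sum_range_succ', Nat.add_sub_cancel]
  ring

theorem sum_sign_mul_bucket {M : ℕ} (hM : 0 < M) (r k : ℕ) :
    ∑ c : Fin (2 * M - 1), (2 * ((((c : ℕ) + 1) / M : ℕ) : ℝ) - 1) *
        (if r * (((c : ℕ) + 1) % M) / M = k then 1 else 0)
      = if k = 0 then 1 else 0 := by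
  rw [sum_fin_succ_eq hM fun t => (2 * ((t / M : ℕ) : ℝ) - 1) *
        (if r * (t % M) / M = k then 1 else 0), Finset.sum_eq_zero]
  · by_cases hk : k = 0 <;> simp [hk, eq_comm]
  · intro j hj
    have hj := Finset.mem_range.1 hj
    simp only [Nat.mod_eq_of_lt hj, Nat.div_eq_of_lt hj, Nat.add_div_left _ hM,
      Nat.add_mod_left]
    split_ifs <;> norm_num

theorem sum_bucket {M : ℕ} (hM : 0 < M) (r k : ℕ) :
    ∑ c : Fin (2 * M - 1), (if r * (((c : ℕ) + 1) % M) / M = k then (1 : ℝ) else 0)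
      = 2 * (((Finset.range M).filter fun j => r * j / M = k).card : ℝ)
        - if k = 0 then 1 else 0 := by
  rw [sum_fin_succ_eq hM fun t => if r * (t % M) / M = k then (1 : ℝ) else 0,
    Finset.card_filter]
  push_cast
  rw [Finset.mul_sum]
  congr 1
  · refine Finset.sum_congr rfl fun j hj => ?_
    have hj := Finset.mem_range.1 hj
    simp only [Nat.mod_eq_of_lt hj, Nat.add_mod_left, two_mul]
  · simp [eq_comm]

theorem mul_mod_div_lt {M r : ℕ} (hM : 0 < M) (hr : 0 < r) (t : ℕ) : r * (t % M) / M < r := by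
  rw [Nat.div_lt_iff_lt_mul hM]
  exact Nat.mul_lt_mul_of_pos_left (Nat.mod_lt _ hM) hr

theorem sum_bucket_zero_le {M r : ℕ} (hM : 0 < M) (hr : 0 < r) :
    ∑ c : Fin (2 * M - 1), (if r * (((c : ℕ) + 1) % M) / M = 0 then (1 : ℝ) else 0)
      ≤ ((2 * M - 1 : ℝ) + (r - 1)) / r := by
  have hr' : (0 : ℝ) < r := by exact_mod_cast hr
  rw [sum_bucket hM, if_pos rfl, le_div_iff₀ hr', card_filter_mul_div_eq hM hr hr]
  have h0 : (0 * M + r - 1) / r = 0 := Nat.div_eq_of_lt (by lia)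
  have h1 : (((0 + 1) * M + r - 1) / r) * r + 1 ≤ M + r := by
    have := Nat.div_mul_le_self ((0 + 1) * M + r - 1) r
    lia
  rw [h0, Nat.sub_zero]
  have : ((((0 + 1) * M + r - 1) / r : ℕ) : ℝ) * r + 1 ≤ M + r := by exact_mod_cast h1
  linarith

theorem sum_bucket_collision_le {M r : ℕ} (hM : 0 < M) (hr : 0 < r) :
    ∑ a : Fin (2 * M - 1), ∑ c : Fin (2 * M - 1),
        (if r * (((a : ℕ) + 1) % M) / M = r * (((c : ℕ) + 1) % M) / M then (1 : ℝ) else 0)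
      ≤ (2 * M - 1 : ℝ) ^ 2 / r + (r - 1) := by
  have hr' : (0 : ℝ) < r := by exact_mod_cast hr
  let ι : Fin (2 * M - 1) → ℕ := fun a => r * (((a : ℕ) + 1) % M) / M
  let w : ℕ → ℝ := fun k => ∑ a, if ι a = k then 1 else 0
  have hι (a) : ι a ∈ Finset.range r := Finset.mem_range.2 (mul_mod_div_lt hM hr _)
  have hw2 : ∑ a, ∑ c, (if ι a = ι c then (1 : ℝ) else 0) = ∑ k ∈ Finset.range r, w k ^ 2 := by
    simp only [w, sq, Finset.sum_mul_sum]
    symm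
    rw [Finset.sum_comm]
    refine Finset.sum_congr rfl fun a _ => ?_
    rw [Finset.sum_comm]
    refine Finset.sum_congr rfl fun c _ => ?_
    simp [hι, eq_comm]
  have hw1 : ∑ k ∈ Finset.range r, w k = 2 * M - 1 := by
    simp only [w]
    rw [Finset.sum_comm]
    simp [hι]
    rw [Nat.cast_sub (by lia)]
    push_cast
    ring
  have hwk (k) (hk : k ∈ Finset.range r) :
      (w k - (2 * ((M + r - 1) / r : ℕ) - 1)) ^ 2 ≤ if k = 0 then 0 else 1 := by
    have hk := Finset.mem_range.1 hk
    simp only [w, ι, sum_bucket hM]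
    split_ifs with h
    · subst h
      rw [card_filter_mul_div_eq hM hr hk]
      simp [Nat.div_eq_of_lt (show r - 1 < r by lia)]
    · obtain h | h := card_filter_mul_div_eq_or hM hr hk
      · rw [h]; ring_nf; rfl
      · rw [← h]; push_cast; ring_nf; rfl
  generalize (2 * (((M + r - 1) / r : ℕ) : ℝ) - 1) = c at hwk
  have hs : ∑ k ∈ Finset.range r, (w k - c) ^ 2
      ≤ ∑ k ∈ Finset.range r, (if k = 0 then (0 : ℝ) else 1) := Finset.sum_le_sum hwk
  have hone : ∑ k ∈ Finset.range r, (if k = 0 then (0 : ℝ) else 1) = r - 1 := by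
    obtain ⟨q, rfl⟩ : ∃ q, r = q + 1 := ⟨r - 1, by lia⟩
    rw [Finset.sum_range_succ']
    simp
  have hex : ∑ k ∈ Finset.range r, (w k - c) ^ 2
      = ∑ k ∈ Finset.range r, w k ^ 2 - 2 * c * (2 * M - 1) + r * c ^ 2 := by
    simp only [sub_sq, Finset.sum_add_distrib, Finset.sum_sub_distrib]
    rw [← Finset.sum_mul, ← Finset.mul_sum, hw1]
    simp
    ring
  rw [hone, hex] at hs
  refine hw2.le.trans ?_
  have : 0 ≤ ((2 * M - 1 : ℝ) - r * c) ^ 2 / r := by positivity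
  have h3 : ((2 * M - 1 : ℝ) - r * c) ^ 2 / r
      = (2 * M - 1 : ℝ) ^ 2 / r - 2 * c * (2 * M - 1) + r * c ^ 2 := by
    field_simp
    ring
  linarith

theorem sum_pairs_delta {ι : Type*} [Fintype ι] [DecidableEq ι] {g : ι → ι → ℝ}
    (hg : ∀ x y, g x y = g y x) (β γ : ℝ) :
    ∑ x, ∑ y, ∑ z, ∑ w, g x y * g z w *
        (β * ((if x = z then 1 else 0) + (if x = w then 1 else 0)
          + (if y = z then 1 else 0) + (if y = w then 1 else 0))
        + γ * ((if x = z then 1 else 0) * (if y = w then 1 else 0)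
          + (if x = w then 1 else 0) * (if y = z then 1 else 0)))
      = 4 * β * ∑ x, (∑ y, g x y) ^ 2 + 2 * γ * ∑ x, ∑ y, g x y ^ 2 := by
  have hcol (x) : ∑ z, g z x = ∑ z, g x z := Finset.sum_congr rfl fun z _ => hg z x
  have hinner (x y) : ∑ z, ∑ w, g x y * g z w *
        (β * ((if x = z then 1 else 0) + (if x = w then 1 else 0)
          + (if y = z then 1 else 0) + (if y = w then 1 else 0))
        + γ * ((if x = z then 1 else 0) * (if y = w then 1 else 0)
          + (if x = w then 1 else 0) * (if y = z then 1 else 0)))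
      = 2 * β * (g x y * ∑ z, g x z) + 2 * β * (g y x * ∑ z, g y z) + 2 * γ * g x y ^ 2 := by
    have h1 (x : ι) : ∑ z, ∑ w, g z w * (if x = z then (1 : ℝ) else 0) = ∑ z, g x z := by
      rw [Finset.sum_comm]; simp
    have h2 (x : ι) : ∑ z, ∑ w, g z w * (if x = w then (1 : ℝ) else 0) = ∑ z, g x z := by
      simp [hcol]
    have h3 (x y : ι) : ∑ z, ∑ w, g z w * ((if x = z then (1 : ℝ) else 0) *
        (if y = w then 1 else 0)) = g x y := by
      simp
    have h4 : ∑ z, ∑ w, g z w * ((if x = w then (1 : ℝ) else 0) *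
        (if y = z then 1 else 0)) = g x y := by
      rw [← h3 y x |>.trans (hg y x)]
      simp only [mul_comm]
    calc _ = g x y * (β * (∑ z, ∑ w, g z w * (if x = z then (1 : ℝ) else 0)
          + ∑ z, ∑ w, g z w * (if x = w then (1 : ℝ) else 0)
          + ∑ z, ∑ w, g z w * (if y = z then (1 : ℝ) else 0)
          + ∑ z, ∑ w, g z w * (if y = w then (1 : ℝ) else 0))
          + γ * (∑ z, ∑ w, g z w * ((if x = z then (1 : ℝ) else 0) * (if y = w then 1 else 0))
          + ∑ z, ∑ w, g z w * ((if x = w then (1 : ℝ) else 0) * (if y = z then 1 else 0)))) := by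
            simp only [Finset.mul_sum, ← Finset.sum_add_distrib]
            refine Finset.sum_congr rfl fun z _ => Finset.sum_congr rfl fun w _ => ?_
            ring
      _ = _ := by
            rw [h1, h2, h1, h2, h3, h4, hg y x]
            ring
  simp only [hinner, Finset.sum_add_distrib, ← Finset.mul_sum]
  rw [Finset.sum_comm (f := fun x y => g y x * ∑ z, g y z)]
  simp only [← Finset.sum_mul, sq]
  ring

theorem sq_sum_le_card_support_mul {ι : Type*} (f : ι → ℝ) (s : Finset ι) :
    (∑ y ∈ s, f y) ^ 2 ≤ (s.filter fun y => f y ≠ 0).card * ∑ y ∈ s, f y ^ 2 := by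
  rw [← Finset.sum_filter_ne_zero s]
  refine sq_sum_le_card_mul_sum_sq.trans ?_
  refine mul_le_mul_of_nonneg_left ?_ (Nat.cast_nonneg _)
  exact Finset.sum_le_sum_of_subset_of_nonneg (Finset.filter_subset _ _)
    fun _ _ _ => sq_nonneg _

/-- The coefficient of the pair `(x, y)` in the estimator, without the diagonal. -/
def offDiag {ι : Type*} [DecidableEq ι] (f : ι → ℝ) (x y : ι) : ℝ :=
  if x = y then 0 else f x * f y

section
variable {ι : Type*} [DecidableEq ι] (f : ι → ℝ)

theorem offDiag_comm (x y : ι) : offDiag f x y = offDiag f y x := by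
  simp [offDiag, eq_comm, mul_comm]

variable [Fintype ι]

theorem sum_mul_mul_eq_add_offDiag (K : ι → ι → ℝ) (hK : ∀ x, K x x = 1) :
    ∑ x, ∑ y, f x * f y * K x y = ∑ x, f x ^ 2 + ∑ x, ∑ y, offDiag f x y * K x y := by
  rw [← Finset.sum_add_distrib]
  refine Finset.sum_congr rfl fun x _ => ?_
  rw [← Finset.add_sum_erase _ _ (Finset.mem_univ x),
    ← Finset.add_sum_erase (a := x) _ _ (Finset.mem_univ x)]
  simp only [hK, offDiag, if_true]
  rw [zero_mul, zero_add, mul_one, sq]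
  congr 1
  refine Finset.sum_congr rfl fun y hy => ?_
  rw [if_neg (Finset.ne_of_mem_erase hy).symm]

theorem sum_offDiag (x : ι) : ∑ y, offDiag f x y = f x * (∑ y, f y - f x) := by
  have : ∀ y, offDiag f x y = f x * f y - if x = y then f x * f y else 0 := fun y => by
    unfold offDiag; split_ifs <;> ring
  simp only [this, Finset.sum_sub_distrib, ← Finset.mul_sum]
  simp
  ring

theorem sum_offDiag_sq (x : ι) : ∑ y, offDiag f x y ^ 2 = f x ^ 2 * (∑ y, f y ^ 2 - f x ^ 2) := by
  rw [← sum_offDiag fun x => f x ^ 2]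
  refine Finset.sum_congr rfl fun y _ => ?_
  unfold offDiag
  split_ifs <;> ring

theorem sq_sum_offDiag_le (x : ι) :
    (∑ y, offDiag f x y) ^ 2
      ≤ ((Finset.univ.filter fun y => f y ≠ 0).card - 1) * ∑ y, offDiag f x y ^ 2 := by
  by_cases hx : f x = 0
  · simp [offDiag, hx]
  refine (sq_sum_le_card_support_mul (offDiag f x) Finset.univ).trans ?_
  refine mul_le_mul_of_nonneg_right ?_ (Finset.sum_nonneg fun _ _ => sq_nonneg _)
  have : (Finset.univ.filter fun y => offDiag f x y ≠ 0)
      = (Finset.univ.filter fun y => f y ≠ 0).erase x := by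
    ext y
    simp [offDiag, hx, eq_comm]
  rw [this, Finset.cast_card_erase_of_mem (by simpa using hx)]

theorem sum_sum_offDiag_sq_le :
    (Finset.univ.filter fun y => f y ≠ 0).card * ∑ x, ∑ y, offDiag f x y ^ 2
      ≤ ((Finset.univ.filter fun y => f y ≠ 0).card - 1) * (∑ x, f x ^ 2) ^ 2 := by
  have h := sq_sum_le_card_support_mul (fun x => f x ^ 2) Finset.univ
  simp only [sum_offDiag_sq, mul_sub, Finset.sum_sub_distrib, ← Finset.sum_mul]
  simp only [ne_eq, OfNat.ofNat_ne_zero, not_false_eq_true, pow_eq_zero_iff] at h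
  simp only [ne_eq, ← sq] at h ⊢
  linarith

end

theorem integrable_comp_finite {Ω β : Type*} [MeasurableSpace Ω] {μ : Measure Ω}
    [IsFiniteMeasure μ] [MeasurableSpace β] [Finite β] [MeasurableSingletonClass β]
    {H : Ω → β} (hH : Measurable H) (g : β → ℝ) : Integrable (fun ω => g (H ω)) μ :=
  (Integrable.of_finite (μ := μ.map H) (f := g)).comp_measurable hH

theorem integral_comp_hash {Ω : Type*} [MeasurableSpace Ω] {μ : Measure Ω} [IsFiniteMeasure μ]
    {u p k : ℕ} {h : Ω → Fin u → Fin p} (hmeas : ∀ x, Measurable fun ω => h ω x)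
    {x : Fin k → Fin u}
    (hx : ∀ y : Fin k → Fin p, μ {ω | ∀ m, h ω (x m) = y m} = (p : ENNReal)⁻¹ ^ k)
    (g : (Fin k → Fin p) → ℝ) :
    ∫ ω, g (fun m => h ω (x m)) ∂μ = (∑ y, g y) / (p : ℝ) ^ k := by
  have hH : Measurable fun ω m => h ω (x m) := measurable_pi_iff.2 fun m => hmeas (x m)
  rw [← integral_map (φ := fun ω m => h ω (x m)) (f := g) hH.aemeasurable
    (measurable_of_finite g).aestronglyMeasurable, integral_fintype .of_finite, Finset.sum_div]
  refine Finset.sum_congr rfl fun y _ => ?_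
  have : (fun ω m => h ω (x m)) ⁻¹' {y} = {ω | ∀ m, h ω (x m) = y m} := by
    ext ω; simp [funext_iff]
  rw [map_measureReal_apply hH (measurableSet_singleton y), this, measureReal_def, hx]
  simp [div_eq_inv_mul]

theorem sum_fin_succ_arrow {α : Type*} [Fintype α] {k : ℕ} (g : (Fin (k + 1) → α) → ℝ) :
    ∑ y, g y = ∑ a, ∑ y : Fin k → α, g (Fin.cons a y) := by
  rw [← Fintype.sum_prod_type', ← (Fin.consEquiv fun _ => α).sum_comp]
  rfl


section

variable {Ω : Type*} [MeasurableSpace Ω] {μ : Measure Ω} [IsFiniteMeasure μ] {u p : ℕ}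
  {h : Ω → Fin u → Fin p}

theorem integral_hash_two (hmeas : ∀ x, Measurable fun ω => h ω x)
    (huniv : ∀ j : ℕ, j ≤ 4 → ∀ x : Fin j → Fin u, Function.Injective x →
      ∀ y : Fin j → Fin p, μ {ω | ∀ m : Fin j, h ω (x m) = y m} = (p : ENNReal)⁻¹ ^ j)
    {x y : Fin u} (hxy : x ≠ y) (g : Fin p → Fin p → ℝ) :
    ∫ ω, g (h ω x) (h ω y) ∂μ = (∑ a, ∑ c, g a c) / (p : ℝ) ^ 2 := by
  have := integral_comp_hash hmeas (x := ![x, y]) (huniv 2 (by norm_num) _ (by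
    simp [Fin.forall_fin_two, Function.Injective, hxy, hxy.symm])) fun t => g (t 0) (t 1)
  simpa [sum_fin_succ_arrow] using this

theorem integral_hash_three (hmeas : ∀ x, Measurable fun ω => h ω x)
    (huniv : ∀ j : ℕ, j ≤ 4 → ∀ x : Fin j → Fin u, Function.Injective x →
      ∀ y : Fin j → Fin p, μ {ω | ∀ m : Fin j, h ω (x m) = y m} = (p : ENNReal)⁻¹ ^ j)
    {x y z : Fin u} (hxy : x ≠ y) (hxz : x ≠ z) (hyz : y ≠ z)
    (g : Fin p → Fin p → Fin p → ℝ) :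
    ∫ ω, g (h ω x) (h ω y) (h ω z) ∂μ = (∑ a, ∑ c, ∑ d, g a c d) / (p : ℝ) ^ 3 := by
  have := integral_comp_hash hmeas (x := ![x, y, z]) (huniv 3 (by norm_num) _ (by
    simp [Fin.forall_fin_succ, Function.Injective, hxy, hxy.symm, hxz, hxz.symm, hyz,
      hyz.symm])) fun t => g (t 0) (t 1) (t 2)
  simp only [sum_fin_succ_arrow, Finset.univ_unique, Finset.sum_singleton] at this
  exact this

theorem integral_hash_four (hmeas : ∀ x, Measurable fun ω => h ω x)
    (huniv : ∀ j : ℕ, j ≤ 4 → ∀ x : Fin j → Fin u, Function.Injective x →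
      ∀ y : Fin j → Fin p, μ {ω | ∀ m : Fin j, h ω (x m) = y m} = (p : ENNReal)⁻¹ ^ j)
    {x y z w : Fin u} (hxy : x ≠ y) (hxz : x ≠ z) (hyz : y ≠ z) (hxw : x ≠ w) (hyw : y ≠ w)
    (hzw : z ≠ w) (g : Fin p → Fin p → Fin p → Fin p → ℝ) :
    ∫ ω, g (h ω x) (h ω y) (h ω z) (h ω w) ∂μ
      = (∑ a, ∑ c, ∑ d, ∑ e, g a c d e) / (p : ℝ) ^ 4 := by
  have := integral_comp_hash hmeas (x := ![x, y, z, w]) (huniv 4 le_rfl _ (by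
    simp [Fin.forall_fin_succ, Function.Injective, hxy, hxy.symm, hxz, hxz.symm, hyz,
      hyz.symm, hxw, hxw.symm, hyw, hyw.symm, hzw, hzw.symm]))
    fun t => g (t 0) (t 1) (t 2) (t 3)
  simp only [sum_fin_succ_arrow, Finset.univ_unique, Finset.sum_singleton] at this
  exact this

theorem integral_kernel_mul_kernel (hmeas : ∀ x, Measurable fun ω => h ω x)
    (huniv : ∀ j : ℕ, j ≤ 4 → ∀ x : Fin j → Fin u, Function.Injective x →
      ∀ y : Fin j → Fin p, μ {ω | ∀ m : Fin j, h ω (x m) = y m} = (p : ENNReal)⁻¹ ^ j)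
    {D : Fin p → Fin p → ℝ} (hD : ∀ a c, D a c = D c a) (hD0 : ∑ a, ∑ c, D a c = 0)
    {β γ : ℝ} (hβ : (∑ a, (∑ c, D a c) ^ 2) / (p : ℝ) ^ 3 = β)
    (hγ : (∑ a, ∑ c, D a c ^ 2) / (p : ℝ) ^ 2 = 2 * β + γ)
    {x y z w : Fin u} (hxy : x ≠ y) (hzw : z ≠ w) :
    ∫ ω, D (h ω x) (h ω y) * D (h ω z) (h ω w) ∂μ
      = β * ((if x = z then 1 else 0) + (if x = w then 1 else 0)
          + (if y = z then 1 else 0) + (if y = w then 1 else 0))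
        + γ * ((if x = z then 1 else 0) * (if y = w then 1 else 0)
          + (if x = w then 1 else 0) * (if y = z then 1 else 0)) := by
  have htwo {x y : Fin u} (hxy : x ≠ y) :
      ∫ ω, D (h ω x) (h ω y) * D (h ω x) (h ω y) ∂μ = 2 * β + γ := by
    rw [integral_hash_two hmeas huniv hxy fun a c => D a c * D a c, ← hγ]
    simp only [sq]
  have hthree {x y z : Fin u} (hxy : x ≠ y) (hxz : x ≠ z) (hyz : y ≠ z) :
      ∫ ω, D (h ω x) (h ω y) * D (h ω x) (h ω z) ∂μ = β := by
    rw [integral_hash_three hmeas huniv hxy hxz hyz fun a c d => D a c * D a d, ← hβ]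
    simp only [sq, Finset.sum_mul_sum]
  by_cases hxz : x = z
  · subst hxz
    by_cases hyw : y = w
    · subst hyw
      rw [htwo hxy]
      simp [hxy, hxy.symm]
      ring
    · rw [hthree hxy hzw hyw]
      simp [hxy.symm, hyw, hzw]
  by_cases hxw : x = w
  · subst hxw
    simp only [hD (h _ z)]
    by_cases hyz : y = z
    · subst hyz
      rw [htwo hxy]
      simp [hxy, hxy.symm]
      ring
    · rw [hthree hxy hxz hyz]
      simp [hxy.symm, hyz, hxz]
  by_cases hyz : y = z
  · subst hyz
    simp only [hD (h _ x)]
    rw [hthree hxy.symm hzw hxw]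
    simp [hxy, hxw, hzw]
  by_cases hyw : y = w
  · subst hyw
    simp only [hD (h _ x), hD (h _ z)]
    rw [hthree hxy.symm (Ne.symm hzw) hxz]
    simp [hxy, hxz, hyz]
  rw [integral_hash_four hmeas huniv hxy hxz hyz hxw hyw hzw fun a c d e => D a c * D d e]
  simp only [← Finset.mul_sum, ← Finset.sum_mul, hD0]
  simp [hxz, hxw, hyz, hyw]

end

section

variable {Ω : Type*} [MeasurableSpace Ω] {μ : Measure Ω} [IsFiniteMeasure μ] {u p : ℕ}
  {h : Ω → Fin u → Fin p}

theorem integral_sum_offDiag_mul_kernel (hmeas : ∀ x, Measurable fun ω => h ω x)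
    (huniv : ∀ j : ℕ, j ≤ 4 → ∀ x : Fin j → Fin u, Function.Injective x →
      ∀ y : Fin j → Fin p, μ {ω | ∀ m : Fin j, h ω (x m) = y m} = (p : ENNReal)⁻¹ ^ j)
    {D : Fin p → Fin p → ℝ} (hD0 : ∑ a, ∑ c, D a c = 0) (f : Fin u → ℝ) :
    ∫ ω, ∑ x, ∑ y, offDiag f x y * D (h ω x) (h ω y) ∂μ = 0 := by
  have hH : Measurable h := measurable_pi_iff.2 hmeas
  have hint (φ : (Fin u → Fin p) → ℝ) : Integrable (fun ω => φ (h ω)) μ :=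
    integrable_comp_finite hH φ
  rw [integral_finsetSum _ fun x _ =>
    hint fun t => ∑ y, offDiag f x y * D (t x) (t y)]
  refine Finset.sum_eq_zero fun x _ => ?_
  rw [integral_finsetSum _ fun y _ => hint fun t => offDiag f x y * D (t x) (t y)]
  refine Finset.sum_eq_zero fun y _ => ?_
  rw [integral_const_mul]
  by_cases hxy : x = y
  · simp [offDiag, hxy]
  · rw [integral_hash_two hmeas huniv hxy, hD0, zero_div, mul_zero]

theorem integral_sq_sum_offDiag_mul_kernel (hmeas : ∀ x, Measurable fun ω => h ω x)
    (huniv : ∀ j : ℕ, j ≤ 4 → ∀ x : Fin j → Fin u, Function.Injective x →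
      ∀ y : Fin j → Fin p, μ {ω | ∀ m : Fin j, h ω (x m) = y m} = (p : ENNReal)⁻¹ ^ j)
    {D : Fin p → Fin p → ℝ} (hD : ∀ a c, D a c = D c a) (hD0 : ∑ a, ∑ c, D a c = 0)
    {β γ : ℝ} (hβ : (∑ a, (∑ c, D a c) ^ 2) / (p : ℝ) ^ 3 = β)
    (hγ : (∑ a, ∑ c, D a c ^ 2) / (p : ℝ) ^ 2 = 2 * β + γ) (f : Fin u → ℝ) :
    ∫ ω, (∑ x, ∑ y, offDiag f x y * D (h ω x) (h ω y)) ^ 2 ∂μ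
      = 4 * β * ∑ x, (∑ y, offDiag f x y) ^ 2 + 2 * γ * ∑ x, ∑ y, offDiag f x y ^ 2 := by
  have hH : Measurable h := measurable_pi_iff.2 hmeas
  have hint (φ : (Fin u → Fin p) → ℝ) : Integrable (fun ω => φ (h ω)) μ :=
    integrable_comp_finite hH φ
  have hexp (ω) : (∑ x, ∑ y, offDiag f x y * D (h ω x) (h ω y)) ^ 2
      = ∑ x, ∑ y, ∑ z, ∑ w, offDiag f x y * offDiag f z w *
          (D (h ω x) (h ω y) * D (h ω z) (h ω w)) := by
    simp only [sq, Finset.sum_mul, Finset.mul_sum]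
    refine Finset.sum_congr rfl fun x _ => Finset.sum_congr rfl fun y _ =>
      Finset.sum_congr rfl fun z _ => Finset.sum_congr rfl fun w _ => ?_
    ring
  simp only [hexp]
  rw [← sum_pairs_delta (offDiag_comm f),
    integral_finsetSum _ fun x _ => hint fun t => ∑ y, ∑ z, ∑ w, offDiag f x y *
      offDiag f z w * (D (t x) (t y) * D (t z) (t w))]
  refine Finset.sum_congr rfl fun x _ => ?_
  rw [integral_finsetSum _ fun y _ => hint fun t => ∑ z, ∑ w, offDiag f x y *
      offDiag f z w * (D (t x) (t y) * D (t z) (t w))]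
  refine Finset.sum_congr rfl fun y _ => ?_
  rw [integral_finsetSum _ fun z _ => hint fun t => ∑ w, offDiag f x y *
      offDiag f z w * (D (t x) (t y) * D (t z) (t w))]
  refine Finset.sum_congr rfl fun z _ => ?_
  rw [integral_finsetSum _ fun w _ => hint fun t => offDiag f x y *
      offDiag f z w * (D (t x) (t y) * D (t z) (t w))]
  refine Finset.sum_congr rfl fun w _ => ?_
  rw [integral_const_mul]
  by_cases hxy : x = y
  · simp [offDiag, hxy]
  by_cases hzw : z = w
  · simp [offDiag, hzw]
  rw [integral_kernel_mul_kernel hmeas huniv hD hD0 hβ hγ hxy hzw]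

end

/-- The contribution `s(x) s(y) [i(x) = i(y)]` of two keys with hash values `a` and `c`, where
`σ` and `ι` give the sign and the bucket of a hash value. -/
def signedCollision {α : Type*} (σ : α → ℝ) (ι : α → ℕ) (a c : α) : ℝ :=
  σ a * σ c * if ι a = ι c then 1 else 0

section

variable {α : Type*} (σ : α → ℝ) (ι : α → ℕ)

theorem signedCollision_comm (a c : α) : signedCollision σ ι a c = signedCollision σ ι c a := by
  simp [signedCollision, eq_comm, mul_comm (σ a)]

theorem sum_sq_bucket_eq {κ : Type*} [Fintype κ] {r : ℕ} (t : κ → α) (hι : ∀ a, ι a < r)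
    (f : κ → ℝ) :
    ∑ j ∈ Finset.range r, (∑ x, σ (t x) * f x * (if ι (t x) = j then 1 else 0)) ^ 2
      = ∑ x, ∑ y, f x * f y * signedCollision σ ι (t x) (t y) := by
  simp only [sq, Finset.sum_mul_sum]
  rw [Finset.sum_comm]
  refine Finset.sum_congr rfl fun x _ => ?_
  rw [Finset.sum_comm]
  refine Finset.sum_congr rfl fun y _ => ?_
  unfold signedCollision
  simp [hι, eq_comm]
  split_ifs <;> ring

variable [Fintype α]

theorem sum_signedCollision
    (hS : ∀ k, ∑ c, σ c * (if ι c = k then 1 else 0) = if k = 0 then 1 else 0) (a : α) :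
    ∑ c, signedCollision σ ι a c = σ a * if ι a = 0 then 1 else 0 := by
  rw [← hS, Finset.mul_sum]
  refine Finset.sum_congr rfl fun c _ => ?_
  simp only [signedCollision, eq_comm, mul_assoc]

theorem sum_sum_signedCollision
    (hS : ∀ k, ∑ c, σ c * (if ι c = k then 1 else 0) = if k = 0 then 1 else 0) :
    ∑ a, ∑ c, signedCollision σ ι a c = 1 := by
  simp only [sum_signedCollision σ ι hS, hS, if_true]

theorem sum_sq_sum_signedCollision (hσ : ∀ a, σ a ^ 2 = 1)
    (hS : ∀ k, ∑ c, σ c * (if ι c = k then 1 else 0) = if k = 0 then 1 else 0) (e : ℝ) :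
    ∑ a, (∑ c, (signedCollision σ ι a c - e)) ^ 2
      = ∑ a, (if ι a = 0 then 1 else 0) - 2 * (Fintype.card α * e)
        + Fintype.card α * (Fintype.card α * e) ^ 2 := by
  have hrow (a) : (∑ c, (signedCollision σ ι a c - e)) ^ 2
      = (if ι a = 0 then 1 else 0)
        - 2 * (Fintype.card α * e) * (σ a * if ι a = 0 then 1 else 0)
        + (Fintype.card α * e) ^ 2 := by
    rw [Finset.sum_sub_distrib, sum_signedCollision σ ι hS, sub_sq, mul_pow, hσ]
    simp
    split_ifs <;> ring
  rw [Finset.sum_congr rfl fun a _ => hrow a]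
  simp only [Finset.sum_add_distrib, Finset.sum_sub_distrib, ← Finset.mul_sum, hS]
  simp

theorem sum_sum_sq_signedCollision (hσ : ∀ a, σ a ^ 2 = 1)
    (hS : ∀ k, ∑ c, σ c * (if ι c = k then 1 else 0) = if k = 0 then 1 else 0) (e : ℝ) :
    ∑ a, ∑ c, (signedCollision σ ι a c - e) ^ 2
      = ∑ a, ∑ c, (if ι a = ι c then 1 else 0) - 2 * e + (Fintype.card α * e) ^ 2 := by
  have hterm (a c) : (signedCollision σ ι a c - e) ^ 2
      = (if ι a = ι c then 1 else 0) - 2 * e * signedCollision σ ι a c + e ^ 2 := by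
    rw [sub_sq]
    congr 2
    · rw [signedCollision, mul_pow, mul_pow, hσ, hσ]
      split_ifs <;> norm_num
    · ring
  simp only [hterm, Finset.sum_add_distrib, Finset.sum_sub_distrib, ← Finset.mul_sum,
    sum_sum_signedCollision σ ι hS]
  simp
  ring

end

theorem variance_bound_arith {n p r A T F β W : ℝ} (hr : 1 < r) (hrp : 2 * r ≤ p + 1)
    (hn : n = 1 ∨ 2 ≤ n) (hnp : 2 * n ≤ p + 1) (hF : 0 < F) (hA : 0 ≤ A)
    (hnA : n * A ≤ (n - 1) * F ^ 2) (hT : T ≤ (n - 1) * A) (hβ0 : 0 ≤ β)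
    (hβ : β ≤ (p + (r - 1)) / r / p ^ 3) (hW : W ≤ (p ^ 2 / r + (r - 1)) / p ^ 2) :
    4 * β * T + 2 * (W - 2 * β) * A < 2 * (1 + (r / (p + 1)) ^ 2) * F ^ 2 / r := by
  have hp : 0 < p := by linarith
  have hr0 : 0 < r := by linarith
  obtain rfl | hn := hn
  · have hA0 : A = 0 := by linarith
    subst hA0
    have : β * T ≤ 0 := mul_nonpos_of_nonneg_of_nonpos hβ0 (by linarith)
    have : 0 < 2 * (1 + (r / (p + 1)) ^ 2) * F ^ 2 / r := by positivity
    linarith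
  set R := (1 + (r / (p + 1)) ^ 2) / r with hR
  have hRr : 1 / r ≤ R := by
    rw [hR]
    gcongr
    nlinarith [sq_nonneg (r / (p + 1))]
  have hWR : W ≤ R := by
    have hkey : (r - 1) / p ^ 2 ≤ r / (p + 1) ^ 2 := by
      rw [div_le_div_iff₀ (by positivity) (by positivity)]
      nlinarith
    calc W ≤ _ := hW
      _ = 1 / r + (r - 1) / p ^ 2 := by field_simp
      _ ≤ 1 / r + r / (p + 1) ^ 2 := by gcongr
      _ = R := by rw [hR]; field_simp
  have hβR : β * p ^ 2 ≤ 3 / 2 * R := by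
    calc β * p ^ 2 ≤ (p + (r - 1)) / r / p ^ 3 * p ^ 2 := by gcongr
      _ = (p + (r - 1)) / p * (1 / r) := by field_simp
      _ ≤ 3 / 2 * (1 / r) := by
        refine mul_le_mul_of_nonneg_right ?_ (by positivity)
        rw [div_le_iff₀ hp]
        linarith
      _ ≤ 3 / 2 * R := by gcongr
  have hRpos : 0 < R := by positivity
  have hnn : 2 * (n - 1) * (n - 2) * β < R := by
    refine lt_of_mul_lt_mul_right (a := p ^ 2) ?_ (by positivity)
    have hnn0 : 0 ≤ 2 * (n - 1) * (n - 2) := by nlinarith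
    have hnp2 : 3 * (n - 1) * (n - 2) < p ^ 2 := by nlinarith
    calc 2 * (n - 1) * (n - 2) * β * p ^ 2 = 2 * (n - 1) * (n - 2) * (β * p ^ 2) := by ring
      _ ≤ 2 * (n - 1) * (n - 2) * (3 / 2 * R) := mul_le_mul_of_nonneg_left hβR hnn0
      _ = R * (3 * (n - 1) * (n - 2)) := by ring
      _ < R * p ^ 2 := mul_lt_mul_of_pos_left hnp2 hRpos
  have h1 : 4 * β * T + 2 * (W - 2 * β) * A ≤ A * (4 * (n - 2) * β + 2 * R) := by
    nlinarith [mul_le_mul_of_nonneg_left hT hβ0, mul_le_mul_of_nonneg_right hWR hA]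
  have hc : 0 ≤ 4 * (n - 2) * β + 2 * R := by
    have : 0 ≤ (n - 2) * β := mul_nonneg (by linarith) hβ0
    linarith
  have h2 : n * (A * (4 * (n - 2) * β + 2 * R)) < n * (2 * R * F ^ 2) := by
    calc n * (A * (4 * (n - 2) * β + 2 * R)) = n * A * (4 * (n - 2) * β + 2 * R) := by ring
      _ ≤ (n - 1) * F ^ 2 * (4 * (n - 2) * β + 2 * R) := mul_le_mul_of_nonneg_right hnA hc
      _ < n * (2 * R * F ^ 2) := by
        have : 0 < F ^ 2 := by positivity
        nlinarith [mul_lt_mul_of_pos_right hnn this]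
  have h3 := lt_of_mul_lt_mul_left h2 (by linarith)
  calc _ ≤ _ := h1
    _ < _ := h3
    _ = _ := by rw [hR]; ring

/-- Theorem 7 (two-for-one Count Sketch with a Mersenne prime, arbitrary number of
buckets): with `u` a power of two, `1 < r ≤ u/2`, `p = 2^b - 1 > u` a prime, `h` a
4-universal hash function into `[p]`, `h_x = h(x)+1`, `j_x = h_x mod 2^(b-1)`,
`i(x) = ⌊r·j_x/2^(b-1)⌋`, `s(x) = 2⌊h_x/2^(b-1)⌋ - 1`, the Count Sketch estimator `X`
satisfies `E[X] = F₂ + (F₁² - F₂)/p²`, `|E[X] - F₂| ≤ F₂(n-1)/p²` and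
`Var[X] < 2(1 + (r/2^b)²)F₂²/r`. -/
theorem stmt10
    {Ω : Type*} [MeasureSpace Ω] [IsProbabilityMeasure (ℙ : Measure Ω)]
    (b u p r : ℕ)
    (hu : ∃ m : ℕ, u = 2 ^ m) (hr1 : 1 < r) (hru : r ≤ u / 2)
    (hp : p = 2 ^ b - 1) (hup : u < p) (hprime : Nat.Prime p)
    (h : Ω → Fin u → Fin p)
    (hmeas : ∀ x : Fin u, Measurable fun ω => h ω x)
    (huniv : ∀ j : ℕ, j ≤ 4 → ∀ x : Fin j → Fin u, Function.Injective x →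
      ∀ y : Fin j → Fin p,
        ℙ {ω | ∀ m : Fin j, h ω (x m) = y m} = (p : ENNReal)⁻¹ ^ j)
    (i : Ω → Fin u → ℕ)
    (hi : ∀ ω x, i ω x = r * (((h ω x : ℕ) + 1) % 2 ^ (b - 1)) / 2 ^ (b - 1))
    (s : Ω → Fin u → ℝ)
    (hs : ∀ ω x, s ω x = 2 * ((((h ω x : ℕ) + 1) / 2 ^ (b - 1) : ℕ) : ℝ) - 1)
    (f : Fin u → ℤ)
    (X : Ω → ℝ)
    (hX : ∀ ω, X ω = ∑ j ∈ Finset.range r,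
      (∑ x : Fin u, s ω x * (f x : ℝ) * (if i ω x = j then 1 else 0)) ^ 2)
    (F₁ F₂ : ℝ) (hF₁ : F₁ = ∑ x : Fin u, (f x : ℝ))
    (hF₂ : F₂ = ∑ x : Fin u, (f x : ℝ) ^ 2)
    (n : ℕ) (hn : n = (Finset.univ.filter fun x => f x ≠ 0).card) (hn1 : 1 ≤ n) :
    (∫ ω, X ω) = F₂ + (F₁ ^ 2 - F₂) / (p : ℝ) ^ 2 ∧
    |(∫ ω, X ω) - F₂| ≤ F₂ * ((n : ℝ) - 1) / (p : ℝ) ^ 2 ∧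
    variance X ℙ < 2 * (1 + ((r : ℝ) / 2 ^ b) ^ 2) * F₂ ^ 2 / (r : ℝ) := by
  have hr0 : 0 < r := by lia
  obtain ⟨m, hm⟩ := hu
  have hb : b ≠ 0 := by rintro rfl; simp at hp; lia
  have hM0 : 0 < 2 ^ (b - 1) := by positivity
  have h2b : 2 ^ b = 2 * 2 ^ (b - 1) := by rw [← pow_succ', Nat.sub_add_cancel (by lia)]
  have huM : u ≤ 2 ^ (b - 1) := by
    have : 2 ^ m < 2 ^ b := by lia
    have := (Nat.pow_lt_pow_iff_right (by norm_num)).1 this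
    rw [hm]
    exact Nat.pow_le_pow_right (by norm_num) (by lia)
  have hR : (2 : ℝ) ^ b = 2 * ((2 ^ (b - 1) : ℕ) : ℝ) := by exact_mod_cast h2b
  rw [hR]
  rw [h2b] at hp
  clear hR h2b
  generalize 2 ^ (b - 1) = M at *
  subst hp
  have hpM : ((2 * M - 1 : ℕ) : ℝ) = 2 * M - 1 := by
    rw [Nat.cast_sub (by lia)]; push_cast; ring
  have hp0 : (0 : ℝ) < ((2 * M - 1 : ℕ) : ℝ) := by exact_mod_cast hprime.pos
  let σ : Fin (2 * M - 1) → ℝ := fun c => 2 * ((((c : ℕ) + 1) / M : ℕ) : ℝ) - 1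
  let ι : Fin (2 * M - 1) → ℕ := fun c => r * (((c : ℕ) + 1) % M) / M
  have hσ (c) : σ c ^ 2 = 1 := by
    have : ((c : ℕ) + 1) / M < 2 := by
      rw [Nat.div_lt_iff_lt_mul hM0]; lia
    simp only [σ]
    interval_cases ((c : ℕ) + 1) / M <;> norm_num
  have hS (k) : ∑ c, σ c * (if ι c = k then 1 else 0) = if k = 0 then 1 else 0 :=
    sum_sign_mul_bucket hM0 r k
  set P : ℝ := ((2 * M - 1 : ℕ) : ℝ) with hP
  let g : Fin u → ℝ := fun x => (f x : ℝ)
  let D : Fin (2 * M - 1) → Fin (2 * M - 1) → ℝ := fun a c => signedCollision σ ι a c - 1 / P ^ 2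
  have hD (a c) : D a c = D c a := by simp only [D, signedCollision_comm σ ι a]
  have hD0 : ∑ a, ∑ c, D a c = 0 := by
    simp only [D, Finset.sum_sub_distrib, sum_sum_signedCollision σ ι hS]
    simp [← hP]
    field_simp
    simp
  let Z : Ω → ℝ := fun ω => ∑ x, ∑ y, offDiag g x y * D (h ω x) (h ω y)
  have hgsum : ∑ x, ∑ y, offDiag g x y = F₁ ^ 2 - F₂ := by
    simp only [sum_offDiag, mul_sub, Finset.sum_sub_distrib, ← Finset.sum_mul, hF₁, hF₂, g, sq]
  have hXZ (ω) : X ω = F₂ + (F₁ ^ 2 - F₂) / P ^ 2 + Z ω := by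
    have h1 : X ω = ∑ x, ∑ y, g x * g y * signedCollision σ ι (h ω x) (h ω y) := by
      rw [hX, ← sum_sq_bucket_eq σ ι (r := r) (h ω) fun a => mul_mod_div_lt hM0 hr0 _]
      simp only [hs, hi, σ, ι, g]
    rw [h1, sum_mul_mul_eq_add_offDiag g (fun x y => signedCollision σ ι (h ω x) (h ω y))
      fun x => by simp [signedCollision, ← sq, hσ], ← hgsum, hF₂]
    simp only [Z, D, mul_sub, Finset.sum_sub_distrib, ← Finset.sum_mul, g]
    ring
  have hH : Measurable h := measurable_pi_iff.2 hmeas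
  have hZmeas : Integrable Z :=
    integrable_comp_finite hH fun t => ∑ x, ∑ y, offDiag g x y * D (t x) (t y)
  have hEZ : ∫ ω, Z ω = 0 := integral_sum_offDiag_mul_kernel hmeas huniv hD0 g
  have hE : ∫ ω, X ω = F₂ + (F₁ ^ 2 - F₂) / P ^ 2 := by
    simp only [hXZ]
    rw [integral_add (integrable_const _) hZmeas, hEZ]
    simp
  have hn1' : (1 : ℝ) ≤ n := by exact_mod_cast hn1
  have hcard : (Finset.univ.filter fun x => g x ≠ 0).card = n := by simp [g, hn]
  have hF₂pos : 0 < F₂ := by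
    obtain ⟨x, hx⟩ := Finset.card_pos.1 (hn ▸ hn1 : 0 < _)
    rw [hF₂]
    refine Finset.sum_pos' (fun _ _ => sq_nonneg _) ⟨x, Finset.mem_univ x, ?_⟩
    have : (f x : ℝ) ≠ 0 := by simpa using hx
    positivity
  have hnA := sum_sum_offDiag_sq_le g
  have hT : ∑ x, (∑ y, offDiag g x y) ^ 2 ≤ (n - 1) * ∑ x, ∑ y, offDiag g x y ^ 2 := by
    rw [Finset.mul_sum]
    exact Finset.sum_le_sum fun x _ => hcard ▸ sq_sum_offDiag_le g x
  rw [hcard] at hnA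
  have hnor : (n : ℝ) = 1 ∨ (2 : ℝ) ≤ n := by
    obtain h | h : n = 1 ∨ 2 ≤ n := by lia
    · exact .inl (by exact_mod_cast h)
    · exact .inr (by exact_mod_cast h)
  refine ⟨hE, ?_, ?_⟩
  · have hcs : F₁ ^ 2 ≤ n * F₂ := by
      rw [hF₁, hF₂, ← hcard]
      exact sq_sum_le_card_support_mul g Finset.univ
    rw [hE, add_sub_cancel_left, abs_div, abs_of_pos (by positivity : 0 < P ^ 2)]
    gcongr
    rw [abs_le]
    refine ⟨?_, by linarith⟩
    obtain h | h := hnor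
    · have hz : ∑ x, ∑ y, offDiag g x y = 0 := by
        have hT0 : ∑ x, (∑ y, offDiag g x y) ^ 2 ≤ 0 := by simpa [h] using hT
        have := (Finset.sum_eq_zero_iff_of_nonneg fun x _ => sq_nonneg _).1
          (le_antisymm hT0 (Finset.sum_nonneg fun x _ => sq_nonneg _))
        exact Finset.sum_eq_zero fun x hx => by simpa using this x hx
      rw [← hgsum, hz, h]
      simp
    · nlinarith [sq_nonneg F₁]
  · have hVar : variance X ℙ = ∫ ω, Z ω ^ 2 := by
      have hXm : AEMeasurable X ℙ := by
        rw [funext hXZ]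
        exact hZmeas.aemeasurable.const_add _
      rw [variance_eq_integral hXm, hE]
      simp only [hXZ, add_sub_cancel_left]
    set w₀ : ℝ := ∑ a, (if ι a = 0 then 1 else 0) with hw₀
    set W : ℝ := ∑ a, ∑ c, (if ι a = ι c then 1 else 0) with hW
    have hw₀le : w₀ ≤ (P + (r - 1)) / r := by
      rw [hpM]; exact sum_bucket_zero_le hM0 hr0
    have hWle : W ≤ P ^ 2 / r + (r - 1) := by
      rw [hpM]; exact sum_bucket_collision_le hM0 hr0
    have hsq := sum_sq_sum_signedCollision σ ι hσ hS (1 / P ^ 2)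
    have hsq2 := sum_sum_sq_signedCollision σ ι hσ hS (1 / P ^ 2)
    rw [Fintype.card_fin, ← hP] at hsq hsq2
    rw [hVar, integral_sq_sum_offDiag_mul_kernel hmeas huniv hD hD0 rfl
      (γ := (∑ a, ∑ c, D a c ^ 2) / P ^ 2 - 2 * ((∑ a, (∑ c, D a c) ^ 2) / P ^ 3)) (by ring) g]
    have h2M : (2 * M : ℝ) = P + 1 := by rw [hpM]; ring
    rw [h2M]
    have hnu : n ≤ u := by
      rw [hn]; exact (Finset.card_le_univ _).trans (by simp)
    refine variance_bound_arith (n := n) (by exact_mod_cast hr1) ?_ hnor ?_ hF₂pos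
      (Finset.sum_nonneg fun _ _ => Finset.sum_nonneg fun _ _ => sq_nonneg _) ?_ hT
      (div_nonneg (Finset.sum_nonneg fun _ _ => sq_nonneg _) (by positivity)) ?_ ?_
    · rw [← h2M]; exact_mod_cast (by lia : 2 * r ≤ 2 * M)
    · rw [← h2M]; exact_mod_cast (by lia : 2 * n ≤ 2 * M)
    · rw [hF₂]; exact hnA
    · refine div_le_div_of_nonneg_right (le_trans ?_ hw₀le) (by positivity)
      rw [hsq]
      have : 2 * (P * (1 / P ^ 2)) - P * (P * (1 / P ^ 2)) ^ 2 = 1 / P := by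
        field_simp; norm_num
      have : 0 < 1 / P := by positivity
      linarith
    · refine div_le_div_of_nonneg_right (le_trans ?_ hWle) (by positivity)
      rw [hsq2]
      have : 2 * (1 / P ^ 2) - (P * (1 / P ^ 2)) ^ 2 = 1 / P ^ 2 := by
        field_simp; norm_num
      have : 0 < 1 / P ^ 2 := by positivity
      linarith
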